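/- Let p and q be primes with p ≡ 5 (mod 8), q ≡ 7 (mod 8) and Legendre symbol (p/q) = 1. Write the fundamental unit of ℚ(√(2pq)) as ε_{2pq} = x + y√(2pq) with x, y positive integers. Then there exist integers y₁ and y₂ such that x + 1 = p·y₁² and x − 1 = 2q·y₂²; in particular 2 = p·y₁² − 2q·y₂² and (y₁√p + y₂√(2q))² = 2·ε_{2pq} in ℝ. -/

import Mathlib

open Real

noncomputable section

/-- `e : ℝ` is a unit greater than `1` of the ring of integers of the real quadratic
field `ℚ(√d)`: it can be written as `(x + y√d)/2` with `x, y ≥ 1` integers satisfying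
`x² - d·y² = ±4`. -/
def IsQuadUnit (d : ℕ) (e : ℝ) : Prop :=
  ∃ x y : ℤ, 1 ≤ x ∧ 1 ≤ y ∧
    (x ^ 2 - (d : ℤ) * y ^ 2 = 4 ∨ x ^ 2 - (d : ℤ) * y ^ 2 = -4) ∧
    2 * e = (x : ℝ) + (y : ℝ) * Real.sqrt d

/-- `e` is the fundamental unit of the real quadratic field `ℚ(√d)` (for `d > 1`
squarefree), i.e. the smallest unit `> 1` of its ring of integers. -/
def IsFundamentalUnit (d : ℕ) (e : ℝ) : Prop :=
  IsQuadUnit d e ∧ ∀ e' : ℝ, IsQuadUnit d e' → e ≤ e'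

theorem Irrational.add_mul_eq_add_mul {t : ℝ} (ht : Irrational t) {a b c d : ℤ}
    (h : (a : ℝ) + b * t = c + d * t) : a = c ∧ b = d := by
  have hbd : b = d := by
    by_contra hne
    have hne' : b - d ≠ 0 := sub_ne_zero.2 hne
    refine ((ht.intCast_mul hne').ne_int (c - a)) ?_
    push_cast
    linarith
  subst hbd
  exact ⟨by exact_mod_cast add_right_cancel h, rfl⟩

/-- If a product of coprime naturals is `m * w ^ 2`, then each factor is a square times a
divisor of `m`, and the two divisors are complementary. -/
theorem exists_eq_mul_sq_of_coprime_of_mul_eq {a b m w : ℕ} (hab : a.Coprime b) (hm : 0 < m)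
    (h : a * b = m * w ^ 2) :
    ∃ d₁ d₂ r s : ℕ, d₁ * d₂ = m ∧ r * s = w ∧ a = d₁ * r ^ 2 ∧ b = d₂ * s ^ 2 := by
  have hgcd : m.gcd a * m.gcd b = m := by
    rw [← Nat.Coprime.gcd_mul m hab, h, Nat.gcd_mul_right_right]
  obtain ⟨a', ha⟩ := Nat.gcd_dvd_right m a
  obtain ⟨b', hb⟩ := Nat.gcd_dvd_right m b
  have hsq : a' * b' = w ^ 2 := by
    apply Nat.eq_of_mul_eq_mul_left hm
    rw [← h]
    conv_rhs => rw [ha, hb]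
    conv_lhs => rw [← hgcd]
    ring
  have hcop : a'.Coprime b' :=
    Nat.Coprime.of_dvd (Dvd.intro_left _ ha.symm) (Dvd.intro_left _ hb.symm) hab
  obtain ⟨r, hr⟩ := exists_eq_pow_of_mul_eq_pow (Nat.isUnit_iff.2 hcop) hsq
  obtain ⟨s, hs⟩ := exists_eq_pow_of_mul_eq_pow (Nat.isUnit_iff.2 hcop.symm)
    ((mul_comm b' a').trans hsq)
  refine ⟨m.gcd a, m.gcd b, r, s, hgcd, ?_, by rw [← hr]; exact ha, by rw [← hs]; exact hb⟩
  apply Nat.pow_left_injective (n := 2) (by norm_num)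
  simp only [mul_pow, ← hr, ← hs, hsq]

/-- A prime factor of a product can be cancelled from one of the two factors. -/
theorem Nat.Prime.exists_eq_mul_of_mul_eq {l a b k : ℕ} (hl : l.Prime) (h : a * b = l * k) :
    (∃ c, a = l * c ∧ c * b = k) ∨ ∃ c, b = l * c ∧ a * c = k := by
  rcases (hl.dvd_mul).1 (Dvd.intro _ h.symm) with ⟨c, rfl⟩ | ⟨c, rfl⟩
  · exact Or.inl ⟨c, rfl, Nat.eq_of_mul_eq_mul_left hl.pos (by rw [← h]; ring)⟩
  · exact Or.inr ⟨c, rfl, Nat.eq_of_mul_eq_mul_left hl.pos (by rw [← h]; ring)⟩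

/-- If `c` is a quadratic nonresidue mod `l`, then `c * s ^ 2` is never `1` mod `l`. -/
theorem legendreSym.mul_sq_add_mul_ne_one {l : ℕ} [Fact l.Prime] {c : ℤ}
    (hc : legendreSym l c = -1) (s k : ℤ) : c * s ^ 2 + l * k ≠ 1 := by
  intro h
  refine (legendreSym.eq_neg_one_iff l).1 hc ⟨c * s, ?_⟩
  have h_cast : (c : ZMod l) * (s : ZMod l) ^ 2 = 1 := by
    simpa using congrArg (Int.cast : ℤ → ZMod l) h
  linear_combination -(c : ZMod l) * h_cast

/-- If `d ≡ 2 (mod 4)`, a unit `x + y√d > 1` of `ℚ(√d)` has norm `1` or `-1` over `ℤ`. -/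
theorem IsQuadUnit.norm_eq {d x y : ℕ} (hd : d % 4 = 2)
    (h : IsQuadUnit d ((x : ℝ) + y * √(d : ℝ))) :
    (x : ℤ) ^ 2 - d * y ^ 2 = 1 ∨ (x : ℤ) ^ 2 - d * y ^ 2 = -1 := by
  obtain ⟨X, Y, -, -, hn, he⟩ := h
  have hirr : Irrational √(d : ℝ) := by
    rw [irrational_sqrt_natCast_iff]
    rintro ⟨r, hr⟩
    rw [hr, Nat.mul_mod] at hd
    have : r % 4 < 4 := Nat.mod_lt _ (by norm_num)
    interval_cases r % 4 <;> simp at hd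
  obtain ⟨rfl, rfl⟩ := hirr.add_mul_eq_add_mul (a := 2 * x) (b := 2 * y) (c := X) (d := Y)
    (by push_cast; linarith)
  rcases hn with hn | hn
  · left; linarith
  · right; linarith

/-- An integral Pell solution gives a quadratic unit. -/
theorem IsQuadUnit.of_pell {d r s : ℕ} (hr : 0 < r) (hs : 0 < s)
    (h : s ^ 2 = d * r ^ 2 + 1) : IsQuadUnit d ((s : ℝ) + r * √(d : ℝ)) := by
  have h_cast : (s : ℤ) ^ 2 = d * r ^ 2 + 1 := by exact_mod_cast h
  refine ⟨2 * s, 2 * r, by lia, by lia, Or.inl ?_, ?_⟩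
  · linear_combination 4 * h_cast
  · push_cast; ring

/-- The fundamental unit is not the square of a Pell solution. -/
theorem IsFundamentalUnit.ne_sq_of_pell {d x y r s : ℕ} (hd : 0 < d)
    (h : IsFundamentalUnit d ((x : ℝ) + y * √(d : ℝ))) (hr : 0 < r) (hs : 0 < s)
    (hpell : s ^ 2 = d * r ^ 2 + 1) (hx : x = 2 * (d * r ^ 2) + 1) : y ≠ 2 * (r * s) := by
  intro hy
  have hle := h.2 _ (IsQuadUnit.of_pell hr hs hpell)
  have hpos : 0 < d * r ^ 2 := by positivity
  have hsx : (s : ℝ) < x := by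
    have : s < x := by nlinarith
    exact_mod_cast this
  have hry : (r : ℝ) ≤ y := by
    have : r ≤ y := by rw [hy]; nlinarith
    exact_mod_cast this
  linarith [mul_le_mul_of_nonneg_right hry (Real.sqrt_nonneg (d : ℝ))]

/-- If `x ^ 2 = 2 * k * y ^ 2 + 1` with `k` odd, then `x` is odd and `y` is even. -/
theorem exists_half_of_sq_eq {k x y : ℕ} (hk : k % 2 = 1) (h : x ^ 2 = 2 * k * y ^ 2 + 1) :
    ∃ a w : ℕ, x = 2 * a + 1 ∧ y = 2 * w ∧ a * (a + 1) = 2 * k * w ^ 2 := by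
  have hx : Odd x := by
    rw [← Nat.odd_pow_iff two_ne_zero, h]
    exact ⟨k * y ^ 2, by ring⟩
  obtain ⟨a, rfl⟩ := hx
  have hk' : 2 * (a ^ 2 + a) = k * y ^ 2 := by nlinarith
  have hy : Even y := by
    have : Even (k * y ^ 2) := ⟨a ^ 2 + a, by rw [← hk']; ring⟩
    rcases Nat.even_mul.1 this with hev | hev
    · exact absurd (Nat.even_iff.1 hev) (by lia)
    · exact (Nat.even_pow.1 hev).1
  obtain ⟨w, rfl⟩ := hy
  exact ⟨a, w, rfl, by ring, by nlinarith⟩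

/-- For `p ≡ 5`, `q ≡ 7 (mod 8)` and `(p/q) = 1`, the fundamental unit `x + y√(2pq)` of
`ℚ(√(2pq))` comes from the factorization `x + 1 = 4ps²`, `x - 1 = 2qr²`. -/
theorem IsFundamentalUnit.exists_factorization {p q : ℕ} [Fact p.Prime] [Fact q.Prime]
    (hp8 : p % 8 = 5) (hq8 : q % 8 = 7) (hleg : legendreSym q (p : ℤ) = 1) {x y : ℕ}
    (hy : 0 < y)
    (hfund : IsFundamentalUnit (2 * p * q) ((x : ℝ) + y * √((2 * p * q : ℕ) : ℝ))) :
    ∃ r s : ℕ, x = 2 * (q * r ^ 2) + 1 ∧ x + 1 = 4 * (p * s ^ 2) ∧ y = 2 * (r * s) := by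
  have hp : p.Prime := Fact.out
  have hq : q.Prime := Fact.out
  have p_neg_one : legendreSym p (-1) = 1 := by
    rw [legendreSym.at_neg_one (by lia), ZMod.χ₄_nat_one_mod_four (by lia)]
  have q_neg_one : legendreSym q (-1) = -1 := by
    rw [legendreSym.at_neg_one (by lia), ZMod.χ₄_nat_three_mod_four (by lia)]
  have p_two : legendreSym p 2 = -1 := by
    rw [legendreSym.at_two (by lia), ZMod.χ₈_nat_eq_if_mod_eight]
    simp [hp8]; lia
  have q_two : legendreSym q 2 = 1 := by
    rw [legendreSym.at_two (by lia), ZMod.χ₈_nat_eq_if_mod_eight]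
    simp [hq8]; lia
  have p_q : legendreSym p (q : ℤ) = 1 := by
    rw [← legendreSym.quadratic_reciprocity_one_mod_four (by lia) (by lia), hleg]
  have hpq_odd : p * q % 2 = 1 := by
    rw [Nat.mul_mod, show p % 2 = 1 by lia, show q % 2 = 1 by lia]
  have hd4 : 2 * p * q % 4 = 2 := by
    rw [mul_assoc]; lia
  have hpell : x ^ 2 = 2 * (p * q) * y ^ 2 + 1 := by
    rcases hfund.1.norm_eq hd4 with h | h
    · zify
      push_cast at h
      linear_combination h
    · refine absurd ?_ (legendreSym.mul_sq_add_mul_ne_one q_neg_one x (2 * p * y ^ 2))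
      push_cast at h
      linear_combination -h
  obtain ⟨a, w, rfl, rfl, haw⟩ := exists_half_of_sq_eq hpq_odd hpell
  obtain ⟨d₁, d₂, r, s, hd, rfl, ha, hs⟩ := exists_eq_mul_sq_of_coprime_of_mul_eq
    (Nat.coprime_self_add_right.2 (Nat.coprime_one_right a))
    (Nat.mul_pos two_pos (Nat.mul_pos hp.pos hq.pos)) haw
  have hrs : d₂ * s ^ 2 = d₁ * r ^ 2 + 1 := by rw [← hs, ← ha]
  have hr0 : 0 < r := Nat.pos_of_ne_zero (by rintro rfl; simp at hy)
  have hs0 : 0 < s := Nat.pos_of_ne_zero (by rintro rfl; simp at hy)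
  zify at hrs
  rcases Nat.prime_two.exists_eq_mul_of_mul_eq hd with ⟨c, rfl, hpq⟩ | ⟨c, rfl, hpq⟩ <;>
  rcases hp.exists_eq_mul_of_mul_eq hpq with ⟨c, rfl, hqe⟩ | ⟨c, rfl, hqe⟩ <;>
  rcases hq.exists_eq_mul_of_mul_eq (hqe.trans (mul_one q).symm) with
    ⟨c, rfl, hone⟩ | ⟨c, rfl, hone⟩ <;>
  obtain ⟨rfl, rfl⟩ := mul_eq_one.1 hone <;> push_cast at hrs
  · exact absurd rfl (hfund.ne_sq_of_pell (by lia) hr0 hs0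
      (by zify; linear_combination hrs) (by rw [ha]; ring))
  · refine absurd ?_ (legendreSym.mul_sq_add_mul_ne_one (l := q) (c := -1 * 2 * p) ?_ r (s ^ 2))
    · linear_combination hrs
    · simp only [legendreSym.mul, q_neg_one, q_two, hleg]; norm_num
  · refine absurd ?_ (legendreSym.mul_sq_add_mul_ne_one (l := p) (c := -1 * 2 * q) ?_ r (s ^ 2))
    · linear_combination hrs
    · simp only [legendreSym.mul, p_neg_one, p_two, p_q]; norm_num
  · refine absurd ?_ (legendreSym.mul_sq_add_mul_ne_one (l := p) (c := -1 * 2) ?_ r (q * s ^ 2))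
    · linear_combination hrs
    · simp only [legendreSym.mul, p_neg_one, p_two]; norm_num
  · refine absurd ?_ (legendreSym.mul_sq_add_mul_ne_one p_two s (-(q * r ^ 2)))
    linear_combination hrs
  · refine absurd ?_ (legendreSym.mul_sq_add_mul_ne_one (l := q) (c := -1 * p) ?_ r (2 * s ^ 2))
    · linear_combination hrs
    · simp only [legendreSym.mul, q_neg_one, hleg]; norm_num
  · exact ⟨r, s, by rw [ha]; ring, by linear_combination 2 * hs, rfl⟩
  · refine absurd ?_ (legendreSym.mul_sq_add_mul_ne_one q_neg_one r (2 * p * s ^ 2))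
    linear_combination hrs


/-- Let `p ≡ 5 (mod 8)` and `q ≡ 7 (mod 8)` be primes with Legendre symbol `(p/q) = 1`.
Write the fundamental unit of `ℚ(√(2pq))` as `ε_{2pq} = x + y√(2pq)` with `x, y`
positive integers.  Then there exist integers `y₁, y₂` with `x + 1 = p·y₁²` and
`x - 1 = 2q·y₂²`; in particular `2 = p·y₁² - 2q·y₂²` and
`(y₁√p + y₂√(2q))² = 2·ε_{2pq}` in `ℝ`. -/
theorem statement_1 (p q : ℕ) (hp : p.Prime) (hq : q.Prime)
    (hp8 : p % 8 = 5) (hq8 : q % 8 = 7)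
    (hleg : @legendreSym q ⟨hq⟩ (p : ℤ) = 1)
    (x y : ℕ) (hx : 0 < x) (hy : 0 < y)
    (hfund : IsFundamentalUnit (2 * p * q)
      ((x : ℝ) + (y : ℝ) * Real.sqrt (2 * p * q))) :
    ∃ y₁ y₂ : ℤ,
      (x : ℤ) + 1 = p * y₁ ^ 2 ∧
      (x : ℤ) - 1 = 2 * q * y₂ ^ 2 ∧
      (2 : ℤ) = p * y₁ ^ 2 - 2 * q * y₂ ^ 2 ∧
      ((y₁ : ℝ) * Real.sqrt p + (y₂ : ℝ) * Real.sqrt (2 * q)) ^ 2 =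
        2 * ((x : ℝ) + (y : ℝ) * Real.sqrt (2 * p * q)) := by
  have : Fact p.Prime := ⟨hp⟩
  have : Fact q.Prime := ⟨hq⟩
  obtain ⟨r, s, hxr, hxs, rfl⟩ := IsFundamentalUnit.exists_factorization hp8 hq8 hleg hy
    (by push_cast; exact hfund)
  zify at hxr hxs
  have hxr' : (x : ℝ) = 2 * (q * r ^ 2) + 1 := by exact_mod_cast hxr
  have hxs' : (x : ℝ) + 1 = 4 * (p * s ^ 2) := by exact_mod_cast hxs
  have hsqrt : √(2 * p * q : ℝ) = √(p : ℝ) * √(2 * q : ℝ) := by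
    rw [← Real.sqrt_mul (Nat.cast_nonneg p)]
    ring_nf
  have hp_sq : √(p : ℝ) ^ 2 = p := Real.sq_sqrt (Nat.cast_nonneg p)
  have hq_sq : √(2 * q : ℝ) ^ 2 = 2 * q := Real.sq_sqrt (by positivity)
  refine ⟨2 * s, r, ?_, ?_, ?_, ?_⟩
  · linear_combination hxs
  · linear_combination hxr
  · linear_combination hxs - hxr
  · rw [hsqrt]
    push_cast
    linear_combination 4 * (s : ℝ) ^ 2 * hp_sq + (r : ℝ) ^ 2 * hq_sq - hxr' - hxs'
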